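/- Let β > 0, ε ∈ ℝ and d ≥ 1. There exists a constant C < ∞ depending only on β and ε such that for all φ, ξ ∈ ℝ^d with (φ,ξ) ≠ (0,0) and all s ∈ ℝ, one has ∫_s^{∞} K(t,s,φ,ξ) · W(t,φ,ξ)^{2β−ε} dt ≤ C · W(s,φ,ξ)^{−ε}. -/

import Mathlib

open MeasureTheory Real

/-- The weight `W(t,φ,ξ) = max(‖ξ - tφ‖, ‖φ‖^{1/(1+2β)})`. -/
noncomputable def Wgt (β : ℝ) {d : ℕ} (t : ℝ) (φ ξ : EuclideanSpace ℝ (Fin d)) : ℝ :=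
  max ‖ξ - t • φ‖ (‖φ‖ ^ (1 / (1 + 2 * β)))

/-- The Kolmogorov kernel `K(t,s,φ,ξ) = exp(-∫_s^t ‖ξ - τφ‖^{2β} dτ)`. -/
noncomputable def Kker (β : ℝ) {d : ℕ} (t s : ℝ) (φ ξ : EuclideanSpace ℝ (Fin d)) : ℝ :=
  Real.exp (-(∫ τ in s..t, ‖ξ - τ • φ‖ ^ (2 * β)))

open scoped RealInnerProductSpace

section Weight

variable {β : ℝ} {d : ℕ} {φ ξ : EuclideanSpace ℝ (Fin d)}

lemma Wgt_pos (h : (φ, ξ) ≠ (0, 0)) (t : ℝ) : 0 < Wgt β t φ ξ := by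
  by_cases hφ : φ = 0
  · subst hφ
    have hξ : ξ ≠ 0 := fun hξ => h (by rw [hξ])
    exact lt_max_of_lt_left (by simpa using hξ)
  · exact lt_max_of_lt_right (rpow_pos_of_pos (norm_pos_iff.2 hφ) _)

lemma continuous_Wgt (β : ℝ) (φ ξ : EuclideanSpace ℝ (Fin d)) :
    Continuous fun t => Wgt β t φ ξ := by
  unfold Wgt
  fun_prop

lemma hasDerivAt_Kker (hβ : 0 < β) (s t : ℝ) :
    HasDerivAt (fun t => Kker β t s φ ξ) (Kker β t s φ ξ * -(‖ξ - t • φ‖ ^ (2 * β))) t := by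
  have hc : Continuous fun τ : ℝ => ‖ξ - τ • φ‖ ^ (2 * β) :=
    Continuous.rpow_const (by fun_prop) fun _ => Or.inr (by positivity)
  exact (intervalIntegral.integral_hasDerivAt_right (hc.intervalIntegrable _ _)
    (hc.stronglyMeasurableAtFilter _ _) hc.continuousAt).neg.exp

end Weight

/-- If `q` lies between `w ^ 2` and `2 * w ^ 2`, then `q ^ (-ε / 2)` is comparable to `w ^ (-ε)`. -/
lemma rpow_neg_half_comparable {w q : ℝ} (ε : ℝ) (hw : 0 < w) (h₁ : w ^ 2 ≤ q)
    (h₂ : q ≤ 2 * w ^ 2) :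
    w ^ (-ε) ≤ 2 ^ |ε| * q ^ (-ε / 2) ∧ q ^ (-ε / 2) ≤ 2 ^ |ε| * w ^ (-ε) := by
  have hq : 0 < q := lt_of_lt_of_le (by positivity) h₁
  have hw2 : (w ^ 2) ^ (-ε / 2) = w ^ (-ε) := by
    rw [← rpow_natCast, ← rpow_mul hw.le]
    congr 1
    push_cast
    ring
  have h2w : (2 * w ^ 2) ^ (-ε / 2) = 2 ^ (-ε / 2) * w ^ (-ε) := by
    rw [mul_rpow (by norm_num) (by positivity), hw2]
  have hwε : 0 < w ^ (-ε) := rpow_pos_of_pos hw _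
  have hqε : 0 < q ^ (-ε / 2) := rpow_pos_of_pos hq _
  have h2 : (1 : ℝ) ≤ 2 ^ |ε| := one_le_rpow (by norm_num) (abs_nonneg _)
  rcases le_total 0 ε with hε | hε
  · have hle : q ^ (-ε / 2) ≤ w ^ (-ε) := hw2 ▸
      rpow_le_rpow_of_nonpos (by positivity) h₁ (by linarith)
    have hge : 2 ^ (-ε / 2) * w ^ (-ε) ≤ q ^ (-ε / 2) := h2w ▸
      rpow_le_rpow_of_nonpos hq h₂ (by linarith)
    refine ⟨?_, by nlinarith⟩
    calc w ^ (-ε) ≤ 2 ^ (ε / 2) * w ^ (-ε) :=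
          le_mul_of_one_le_left hwε.le (one_le_rpow (by norm_num) (by linarith))
      _ = 2 ^ |ε| * (2 ^ (-ε / 2) * w ^ (-ε)) := by
          rw [← mul_assoc, ← rpow_add (by norm_num), abs_of_nonneg hε]
          ring_nf
      _ ≤ _ := by gcongr
  · have hle : w ^ (-ε) ≤ q ^ (-ε / 2) := hw2 ▸
      rpow_le_rpow (by positivity) h₁ (by linarith)
    have hge : q ^ (-ε / 2) ≤ 2 ^ (-ε / 2) * w ^ (-ε) := h2w ▸
      rpow_le_rpow hq.le h₂ (by linarith)
    refine ⟨by nlinarith, hge.trans ?_⟩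
    gcongr
    · norm_num
    · rw [abs_of_nonpos hε]
      linarith

lemma exp_neg_mul_arctan_bounds {A : ℝ} (hA : 0 ≤ A) (x : ℝ) :
    exp (-(2 * A)) ≤ exp (-(A * arctan x)) ∧ exp (-(A * arctan x)) ≤ exp (2 * A) := by
  have h₁ := arctan_lt_pi_div_two x
  have h₂ := neg_pi_div_two_lt_arctan x
  have h₃ := pi_le_four
  constructor <;> apply exp_le_exp.2 <;> nlinarith

/-- The logarithmic derivative bound behind the Lyapunov function: `r` plays the role of
`‖ξ - t • φ‖`, `a ^ (1 + 2β)` that of `‖φ‖`, and `x` that of `⟪ξ - t • φ, φ⟫`. -/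
lemma logDeriv_lyapunov_le {β ε M a r x : ℝ} (hβ : 0 < β) (hM : M = 1 + 2 * |ε|) (ha : 0 ≤ a)
    (hr : 0 ≤ r) (hpos : 0 < max r a) (hx : |x| ≤ r * (a ^ (2 * β) * a)) :
    ε * x / (r ^ 2 + a ^ 2)
        - (1 + M ^ 2) * (|ε| + M ^ (2 * β)) *
          (a ^ (2 * β) / (1 + (-x / (a ^ (2 * β) * a * a)) ^ 2))
      ≤ r ^ (2 * β) - 1 / 2 * max r a ^ (2 * β) := by
  have hε := abs_nonneg ε
  have hM1 : 1 ≤ M := by linarith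
  have hM0 : 0 ≤ M := by linarith
  have hp : 0 ≤ a ^ (2 * β) := rpow_nonneg ha _
  have hMp : 1 ≤ M ^ (2 * β) := one_le_rpow hM1 (by positivity)
  have hq : 0 < r ^ 2 + a ^ 2 := by
    rcases lt_max_iff.1 hpos with h | h <;> positivity
  have hεx : ε * x ≤ |ε| * (r * (a ^ (2 * β) * a)) :=
    (le_abs_self _).trans (by rw [abs_mul]; gcongr)
  rcases le_total (M * a) r with h | h
  · have har : a ≤ r := by nlinarith
    have hpr : a ^ (2 * β) ≤ r ^ (2 * β) := rpow_le_rpow ha har (by positivity)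
    have hfst : ε * x / (r ^ 2 + a ^ 2) ≤ 1 / 2 * r ^ (2 * β) := by
      rw [div_le_iff₀ hq]
      have h₁ : |ε| * a ≤ 1 / 2 * r := by nlinarith
      calc ε * x ≤ (|ε| * a) * (r * a ^ (2 * β)) := by linarith
        _ ≤ (1 / 2 * r) * (r * r ^ (2 * β)) := by gcongr
        _ = 1 / 2 * r ^ (2 * β) * r ^ 2 := by ring
        _ ≤ _ := by gcongr; nlinarith
    have hsnd : 0 ≤ (1 + M ^ 2) * (|ε| + M ^ (2 * β)) *
          (a ^ (2 * β) / (1 + (-x / (a ^ (2 * β) * a * a)) ^ 2)) := by positivity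
    rw [max_eq_left har]
    linarith
  · have hfst : ε * x / (r ^ 2 + a ^ 2) ≤ |ε| * a ^ (2 * β) := by
      rw [div_le_iff₀ hq]
      calc ε * x ≤ (|ε| * a ^ (2 * β)) * (r * a) := by linarith
        _ ≤ _ := by gcongr; nlinarith [sq_nonneg (r - a)]
    have hv : (-x / (a ^ (2 * β) * a * a)) ^ 2 ≤ M ^ 2 := by
      rw [← sq_abs, abs_div, abs_neg, abs_of_nonneg (by positivity : 0 ≤ a ^ (2 * β) * a * a)]
      gcongr
      refine div_le_of_le_mul₀ (by positivity) hM0 (hx.trans ?_)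
      calc r * (a ^ (2 * β) * a) ≤ (M * a) * (a ^ (2 * β) * a) := by gcongr
        _ = _ := by ring
    have hsnd : (|ε| + M ^ (2 * β)) * a ^ (2 * β) ≤ (1 + M ^ 2) * (|ε| + M ^ (2 * β)) *
          (a ^ (2 * β) / (1 + (-x / (a ^ (2 * β) * a * a)) ^ 2)) := by
      rw [← mul_div_assoc, le_div_iff₀ (by positivity)]
      calc _ ≤ (|ε| + M ^ (2 * β)) * a ^ (2 * β) * (1 + M ^ 2) := by gcongr
        _ = _ := by ring
    have hW : max r a ^ (2 * β) ≤ M ^ (2 * β) * a ^ (2 * β) := by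
      rw [← mul_rpow hM0 ha]
      exact rpow_le_rpow hpos.le (max_le h (by nlinarith)) (by positivity)
    have h₁ : 0 ≤ r ^ (2 * β) := rpow_nonneg hr _
    have h₂ : 0 ≤ max r a ^ (2 * β) := rpow_nonneg hpos.le _
    linarith

/-- A function comparable to `W ^ (-ε)` which, multiplied by the Kolmogorov kernel, decreases at
rate at least `W ^ (2β) / 2`. -/
noncomputable def lyapunov (ε A a : ℝ) {d : ℕ} (φ ξ : EuclideanSpace ℝ (Fin d)) (t : ℝ) : ℝ :=
  (‖ξ - t • φ‖ ^ 2 + a ^ 2) ^ (-ε / 2) * exp (-(A * arctan (-⟪ξ - t • φ, φ⟫ / (‖φ‖ * a))))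

lemma hasDerivAt_lyapunov (ε A a : ℝ) {d : ℕ} (φ ξ : EuclideanSpace ℝ (Fin d)) (t : ℝ)
    (hq : 0 < ‖ξ - t • φ‖ ^ 2 + a ^ 2) :
    HasDerivAt (lyapunov ε A a φ ξ)
      (lyapunov ε A a φ ξ t * (ε * ⟪ξ - t • φ, φ⟫ / (‖ξ - t • φ‖ ^ 2 + a ^ 2)
        - A * (‖φ‖ / a / (1 + (-⟪ξ - t • φ, φ⟫ / (‖φ‖ * a)) ^ 2)))) t := by
  have hy : HasDerivAt (fun t : ℝ => ξ - t • φ) (-φ) t := by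
    simpa using ((hasDerivAt_id t).smul_const φ).const_sub ξ
  have hb := (hy.norm_sq.add_const (a ^ 2)).rpow_const (p := -ε / 2) (Or.inl hq.ne')
  have hv := ((((hy.inner ℝ (hasDerivAt_const t φ)).neg.div_const (‖φ‖ * a)).arctan).const_mul
    A).neg.exp
  refine (hb.mul hv).congr_deriv ?_
  have hn : ‖φ‖ * ‖φ‖ / (‖φ‖ * a) = ‖φ‖ / a := by
    rcases eq_or_ne ‖φ‖ 0 with h | h
    · simp [h]
    · exact mul_div_mul_left _ _ h
  have hi : -(⟪ξ - t • φ, 0⟫ + ⟪-φ, φ⟫) / (‖φ‖ * a) = ‖φ‖ / a := by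
    rw [inner_zero_right, inner_neg_left, real_inner_self_eq_norm_mul_norm, ← hn]
    ring
  simp only [Pi.neg_apply] at *
  rw [hi, rpow_sub_one hq.ne', inner_neg_right, lyapunov]
  field_simp
  ring

/-- Estimate (2.16): `∫_s^∞ K(t,s,φ,ξ) W(t,φ,ξ)^{2β-ε} dt ≲ W(s,φ,ξ)^{-ε}` with a
constant depending only on `β` and `ε`. -/
theorem kernel_weighted_integral_in_t (β ε : ℝ) (hβ : 0 < β) :
    ∃ C : ℝ,
      ∀ (d : ℕ), 1 ≤ d → ∀ φ ξ : EuclideanSpace ℝ (Fin d), (φ, ξ) ≠ (0, 0) →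
        ∀ s : ℝ,
          (∫ t in Set.Ici s, Kker β t s φ ξ * Wgt β t φ ξ ^ (2 * β - ε))
            ≤ C * Wgt β s φ ξ ^ (-ε) := by
  set M : ℝ := 1 + 2 * |ε| with hM
  have hM0 : 0 ≤ M := by positivity
  set A : ℝ := (1 + M ^ 2) * (|ε| + M ^ (2 * β)) with hAdef
  have hA : 0 ≤ A := by positivity
  set D : ℝ := 2 ^ |ε| * exp (2 * A) with hD
  refine ⟨2 * D * D, fun d _ φ ξ h s => ?_⟩
  set a : ℝ := ‖φ‖ ^ (1 / (1 + 2 * β)) with ha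
  have ha0 : 0 ≤ a := by positivity
  have hφ : ‖φ‖ = a ^ (2 * β) * a := by
    rw [← rpow_add_one' ha0 (by positivity), ha, ← rpow_mul (norm_nonneg _), add_comm (2 * β),
      one_div_mul_cancel (by positivity), rpow_one]
  have hφa : ‖φ‖ / a = a ^ (2 * β) := by
    rcases eq_or_ne a 0 with h0 | h0
    · rw [h0, zero_rpow (by positivity), div_zero]
    · rw [hφ, mul_div_cancel_right₀ _ h0]
  have hW : ∀ t, 0 < Wgt β t φ ξ := Wgt_pos h
  have hWdef : ∀ t, Wgt β t φ ξ = max ‖ξ - t • φ‖ a := fun _ => rfl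
  have hq₁ : ∀ t, Wgt β t φ ξ ^ 2 ≤ ‖ξ - t • φ‖ ^ 2 + a ^ 2 := fun t => by
    rw [hWdef]
    rcases max_choice ‖ξ - t • φ‖ a with h | h <;> rw [h] <;> nlinarith [sq_nonneg ‖ξ - t • φ‖]
  have hq₂ : ∀ t, ‖ξ - t • φ‖ ^ 2 + a ^ 2 ≤ 2 * Wgt β t φ ξ ^ 2 := fun t => by
    have h₁ := pow_le_pow_left₀ (norm_nonneg _) (le_max_left ‖ξ - t • φ‖ a) 2
    have h₂ := pow_le_pow_left₀ ha0 (le_max_right ‖ξ - t • φ‖ a) 2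
    rw [hWdef]
    linarith
  set V := lyapunov ε A a φ ξ with hV
  have hV₁ : ∀ t, Wgt β t φ ξ ^ (-ε) ≤ D * V t := fun t => by
    have h₁ := (rpow_neg_half_comparable ε (hW t) (hq₁ t) (hq₂ t)).1
    have h₂ := (exp_neg_mul_arctan_bounds hA (-⟪ξ - t • φ, φ⟫ / (‖φ‖ * a))).1
    refine h₁.trans ?_
    rw [hD, hV, lyapunov]
    calc _ = 2 ^ |ε| * exp (2 * A) * ((‖ξ - t • φ‖ ^ 2 + a ^ 2) ^ (-ε / 2) * exp (-(2 * A))) := by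
          rw [exp_neg]
          field_simp
      _ ≤ _ := by gcongr
  have hV₂ : ∀ t, V t ≤ D * Wgt β t φ ξ ^ (-ε) := fun t => by
    have h₁ := (rpow_neg_half_comparable ε (hW t) (hq₁ t) (hq₂ t)).2
    have h₂ := (exp_neg_mul_arctan_bounds hA (-⟪ξ - t • φ, φ⟫ / (‖φ‖ * a))).2
    have h₃ := (rpow_pos_of_pos (hW t) (-ε)).le
    calc V t ≤ (2 ^ |ε| * Wgt β t φ ξ ^ (-ε)) * exp (2 * A) := by
          rw [hV, lyapunov]
          gcongr
      _ = _ := by rw [hD]; ring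
  have hV0 : ∀ t, 0 ≤ V t := fun t => by
    rw [hV, lyapunov]
    positivity
  have hK0 : ∀ t, 0 ≤ Kker β t s φ ξ := fun t => (exp_pos _).le
  have hD0 : 0 ≤ D := by positivity
  set f : ℝ → ℝ := fun t => Kker β t s φ ξ * Wgt β t φ ξ ^ (2 * β - ε) with hf
  have hfc : Continuous f := by
    refine Continuous.mul ?_ ((continuous_Wgt β φ ξ).rpow_const fun t => Or.inl (hW t).ne')
    exact continuous_iff_continuousAt.2 fun t => (hasDerivAt_Kker hβ s t).continuousAt
  set L : ℝ → ℝ := fun t => ε * ⟪ξ - t • φ, φ⟫ / (‖ξ - t • φ‖ ^ 2 + a ^ 2)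
        - A * (‖φ‖ / a / (1 + (-⟪ξ - t • φ, φ⟫ / (‖φ‖ * a)) ^ 2)) with hL
  have hLle : ∀ t, L t ≤ ‖ξ - t • φ‖ ^ (2 * β) - 1 / 2 * Wgt β t φ ξ ^ (2 * β) := fun t => by
    have := logDeriv_lyapunov_le (x := ⟪ξ - t • φ, φ⟫) (r := ‖ξ - t • φ‖) hβ hM ha0
      (norm_nonneg _) (hW t) (by rw [← hφ]; exact abs_real_inner_le_norm _ _)
    rw [← hφ, ← hφa] at this
    simpa only [hL, hAdef, hWdef, hφa] using this
  have hderiv : ∀ t, HasDerivAt (fun t => -(2 * D) * (Kker β t s φ ξ * V t))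
      (-(2 * D) * (Kker β t s φ ξ * V t * (L t - ‖ξ - t • φ‖ ^ (2 * β)))) t := fun t => by
    have hq : 0 < ‖ξ - t • φ‖ ^ 2 + a ^ 2 := lt_of_lt_of_le (pow_pos (hW t) 2) (hq₁ t)
    refine (((hasDerivAt_Kker hβ s t).mul (hasDerivAt_lyapunov ε A a φ ξ t hq)).const_mul
      (-(2 * D))).congr_deriv ?_
    simp only [hL, hV]
    ring
  have hfle : ∀ t, f t ≤ -(2 * D) * (Kker β t s φ ξ * V t * (L t - ‖ξ - t • φ‖ ^ (2 * β))) :=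
    fun t => by
      have hWβ := (rpow_pos_of_pos (hW t) (2 * β)).le
      calc f t = Kker β t s φ ξ * Wgt β t φ ξ ^ (2 * β) * Wgt β t φ ξ ^ (-ε) := by
            rw [hf, mul_assoc, ← rpow_add (hW t), ← sub_eq_add_neg]
        _ ≤ Kker β t s φ ξ * Wgt β t φ ξ ^ (2 * β) * (D * V t) :=
            mul_le_mul_of_nonneg_left (hV₁ t) (mul_nonneg (hK0 t) hWβ)
        _ = 2 * D * (Kker β t s φ ξ * V t) * (1 / 2 * Wgt β t φ ξ ^ (2 * β)) := by ring
        _ ≤ 2 * D * (Kker β t s φ ξ * V t) * (‖ξ - t • φ‖ ^ (2 * β) - L t) :=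
            mul_le_mul_of_nonneg_left (by linarith [hLle t])
              (mul_nonneg (by positivity) (mul_nonneg (hK0 t) (hV0 t)))
        _ = _ := by ring
  have hbound : ∀ T, s ≤ T → ∫ t in s..T, f t ≤ 2 * D * D * Wgt β s φ ξ ^ (-ε) := fun T hT => by
    have h₁ := intervalIntegral.integral_le_sub_of_hasDeriv_right_of_le hT
      (fun t _ => (hderiv t).continuousAt.continuousWithinAt)
      (fun t _ => (hderiv t).hasDerivWithinAt) hfc.continuousOn.integrableOn_Icc
      (fun t _ => hfle t)
    have hKs : Kker β s s φ ξ = 1 := by simp [Kker]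
    have h₂ : 0 ≤ 2 * D * (Kker β T s φ ξ * V T) :=
      mul_nonneg (by positivity) (mul_nonneg (hK0 T) (hV0 T))
    have h₃ : 2 * D * V s ≤ 2 * D * (D * Wgt β s φ ξ ^ (-ε)) :=
      mul_le_mul_of_nonneg_left (hV₂ s) (by positivity)
    rw [hKs] at h₁
    linarith
  rw [integral_Ici_eq_integral_Ioi]
  by_cases hint : IntegrableOn f (Set.Ioi s)
  · exact le_of_tendsto (intervalIntegral_tendsto_integral_Ioi s hint Filter.tendsto_id)
      (Filter.eventually_atTop.2 ⟨s, hbound⟩)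
  · rw [integral_undef hint]
    have := (rpow_pos_of_pos (hW s) (-ε)).le
    positivity
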